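/- Suppose Assumptions A1 and A2 hold, 0 < p < (1−q)/2, 5q + 2s − 1 < 0, 4q + s + p − 2 < 0, and additionally 0 < p < 2q + s. Let (x,λ) be a global solution of the dynamical system, let (x_t,λ_t) be the unique saddle point of L_t with t ↦ (x_t,λ_t) continuously differentiable, and let (x*,λ*) be the projection of the origin onto Ω. Then, as t → +∞: L(x(t),λ*) − L(x*,λ*) = O(√(m(t)) t^{(3q+s−p−1)/2} + t^{−p}), |f(x(t)) − f(x*)| = O(√(m(t)) t^{(3q+s−p−1)/2} + t^{−p}), ‖Ax(t) − b‖ = O(√(m(t)) t^{(3q+s−p−1)/2} + t^{−p}), and ‖(x(t)−x_t, λ(t)−λ_t)‖² = O(m(t) t^{3q+s−p−1}). -/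

import Mathlib

open Real Filter Asymptotics
open scoped RealInnerProductSpace Topology

theorem ConvexOn.add_inner_le_of_hasGradientAt {X : Type*} [NormedAddCommGroup X]
    [InnerProductSpace ℝ X] [CompleteSpace X] {f : X → ℝ} (hconv : ConvexOn ℝ Set.univ f)
    {g u : X} (hf : HasGradientAt f g u) (v : X) : f u + ⟪g, v - u⟫ ≤ f v := by
  have hline : HasDerivAt (fun r : ℝ => AffineMap.lineMap u v r) (v - u) (0 : ℝ) :=
    AffineMap.hasDerivAt_lineMap
  have hd : HasDerivAt (f ∘ (AffineMap.lineMap u v : ℝ →ᵃ[ℝ] X)) ⟪g, v - u⟫ 0 := by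
    have h0 : HasFDerivAt f (InnerProductSpace.toDual ℝ X g)
        ((fun r : ℝ => AffineMap.lineMap u v r) (0 : ℝ)) := by
      simpa using hf.hasFDerivAt
    simpa using h0.comp_hasDerivAt (0 : ℝ) hline
  have hc : ConvexOn ℝ Set.univ (f ∘ (AffineMap.lineMap u v : ℝ →ᵃ[ℝ] X)) := by
    simpa using hconv.comp_affineMap (AffineMap.lineMap u v : ℝ →ᵃ[ℝ] X)
  have := hc.le_slope_of_hasDerivAt (Set.mem_univ 0) (Set.mem_univ 1) one_pos hd
  simp [slope_def_field] at this
  linarith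

/-- Continuous paths `z` with `⟪g τ - g t, z τ - z t⟫` nonpositive to the right of `t`
have derivatives at an obtuse angle. Stated for a pair of components. -/
theorem inner_deriv_add_inner_deriv_nonpos {X Y : Type*} [NormedAddCommGroup X]
    [InnerProductSpace ℝ X] [NormedAddCommGroup Y] [InnerProductSpace ℝ Y]
    {g z : ℝ → X} {h w : ℝ → Y} {g' z' : X} {h' w' : Y} {t : ℝ}
    (hg : HasDerivAt g g' t) (hz : HasDerivAt z z' t)
    (hh : HasDerivAt h h' t) (hw : HasDerivAt w w' t)
    (hle : ∀ τ > t, ⟪g τ - g t, z τ - z t⟫ + ⟪h τ - h t, w τ - w t⟫ ≤ 0) :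
    ⟪g', z'⟫ + ⟪h', w'⟫ ≤ 0 := by
  have hsub : 𝓝[>] t ≤ 𝓝[≠] t := nhdsWithin_mono _ fun τ hτ => ne_of_gt hτ
  have lim := (((hasDerivAt_iff_tendsto_slope.1 hg).mono_left hsub).inner
    ((hasDerivAt_iff_tendsto_slope.1 hz).mono_left hsub) (𝕜 := ℝ)).add
    (((hasDerivAt_iff_tendsto_slope.1 hh).mono_left hsub).inner
    ((hasDerivAt_iff_tendsto_slope.1 hw).mono_left hsub) (𝕜 := ℝ))
  refine le_of_tendsto lim ?_
  filter_upwards [self_mem_nhdsWithin] with τ hτ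
  have hτ' : 0 < (τ - t)⁻¹ := inv_pos.2 (sub_pos.2 hτ)
  simp only [slope_def_module, inner_smul_left, inner_smul_right, conj_trivial]
  calc _ = (τ - t)⁻¹ * (τ - t)⁻¹ *
        (⟪g τ - g t, z τ - z t⟫ + ⟪h τ - h t, w τ - w t⟫) := by ring
    _ ≤ 0 := mul_nonpos_of_nonneg_of_nonpos (by positivity) (hle τ hτ)

section SaddlePath

variable {X Y : Type*} [NormedAddCommGroup X] [InnerProductSpace ℝ X] [CompleteSpace X]
  [NormedAddCommGroup Y] [InnerProductSpace ℝ Y] [CompleteSpace Y]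
  {f : X → ℝ} {f' : X → X} {A : X →L[ℝ] Y} {b : Y}

/-- Strong convexity of the regularized Lagrangian at a critical point `u₀`. -/
theorem regularized_gap_ge (hf : ∀ u, HasGradientAt f (f' u) u) (hconv : ConvexOn ℝ Set.univ f)
    {ε : ℝ} {u₀ : X} {μ₀ : Y}
    (h0 : f' u₀ + ContinuousLinearMap.adjoint A μ₀ + ε • u₀ = 0) (u : X) :
    ε / 2 * ‖u - u₀‖ ^ 2 ≤ f u - f u₀ + ⟪μ₀, A (u - u₀)⟫ + ε / 2 * (‖u‖ ^ 2 - ‖u₀‖ ^ 2) := by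
  have h1 := hconv.add_inner_le_of_hasGradientAt (hf u₀) u
  have h2 : ⟪f' u₀ + ContinuousLinearMap.adjoint A μ₀ + ε • u₀, u - u₀⟫ = 0 := by simp [h0]
  rw [inner_add_left, inner_add_left, ContinuousLinearMap.adjoint_inner_left, inner_smul_left,
    conj_trivial] at h2
  have h3 : ‖u‖ ^ 2 = ‖u₀‖ ^ 2 + 2 * ⟪u₀, u - u₀⟫ + ‖u - u₀‖ ^ 2 := by
    rw [← norm_add_sq_real, add_sub_cancel]
  rw [h3]
  linarith

theorem regularized_gap_add_le (hf : ∀ u, HasGradientAt f (f' u) u)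
    (hconv : ConvexOn ℝ Set.univ f) {ε : ℝ} (u u₀ : X) (μ₀ : Y) :
    f u - f u₀ + ⟪μ₀, A (u - u₀)⟫ + ε / 2 * (‖u‖ ^ 2 - ‖u₀‖ ^ 2) + ε / 2 * ‖u - u₀‖ ^ 2
      ≤ ⟪f' u + ContinuousLinearMap.adjoint A μ₀ + ε • u, u - u₀⟫ := by
  have h1 := hconv.add_inner_le_of_hasGradientAt (hf u) u₀
  rw [inner_add_left, inner_add_left, ContinuousLinearMap.adjoint_inner_left, inner_smul_left,
    conj_trivial]
  have h3 : ‖u₀‖ ^ 2 = ‖u‖ ^ 2 - 2 * ⟪u, u - u₀⟫ + ‖u - u₀‖ ^ 2 := by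
    rw [← norm_sub_sq_real, sub_sub_cancel]
  rw [← neg_sub u u₀, inner_neg_right] at h1
  rw [h3]
  linarith

/-- The saddle point of the regularized Lagrangian is no larger than any saddle point of the
Lagrangian. -/
theorem norm_sq_regularized_saddle_le (hf : ∀ u, HasGradientAt f (f' u) u)
    (hconv : ConvexOn ℝ Set.univ f) {ε : ℝ} (hε : 0 < ε) {u₀ us : X} {μ₀ μs : Y}
    (h0 : f' u₀ + ContinuousLinearMap.adjoint A μ₀ + ε • u₀ = 0)
    (h0' : A u₀ - b - ε • μ₀ = 0) (hfeas : A us = b)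
    (hopt : ∀ u, f us ≤ f u + ⟪μs, A u - b⟫) :
    ‖u₀‖ ^ 2 + ‖μ₀‖ ^ 2 ≤ ‖us‖ ^ 2 + ‖μs‖ ^ 2 := by
  have h1 := regularized_gap_ge hf hconv h0 us
  have h2 := hopt u₀
  have h3 : A u₀ - b = ε • μ₀ := sub_eq_zero.1 h0'
  have h4 : A (us - u₀) = -(ε • μ₀) := by rw [map_sub, hfeas, ← h3, neg_sub]
  rw [h4, inner_neg_right, inner_smul_right, real_inner_self_eq_norm_sq] at h1
  rw [h3, inner_smul_right] at h2
  have h5 : 2 * ⟪μs, μ₀⟫ ≤ ‖μs‖ ^ 2 + ‖μ₀‖ ^ 2 := by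
    have := norm_sub_sq_real μs μ₀
    nlinarith [sq_nonneg ‖μs - μ₀‖]
  have h6 : 0 ≤ ε / 2 * ‖us - u₀‖ ^ 2 := by positivity
  have h7 : ε * (2 * ⟪μs, μ₀⟫) ≤ ε * (‖μs‖ ^ 2 + ‖μ₀‖ ^ 2) :=
    mul_le_mul_of_nonneg_left h5 hε.le
  have h8 : ε * (‖u₀‖ ^ 2 + ‖μ₀‖ ^ 2) ≤ ε * (‖us‖ ^ 2 + ‖μs‖ ^ 2) := by linarith
  exact le_of_mul_le_mul_left h8 hε

/-- Speed of the path of regularized saddle points: if `ε' = -r ε` at time `t`, then the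
squared speed is at most `r ^ 2` times the squared norm. -/
theorem norm_sq_deriv_regularized_saddle_le (hf : ∀ u, HasGradientAt f (f' u) u)
    (hconv : ConvexOn ℝ Set.univ f) {ε : ℝ → ℝ} {r t : ℝ} (hεt : 0 < ε t)
    (hε : HasDerivAt ε (-(r * ε t)) t) {u : ℝ → X} {μ : ℝ → Y} {u' : X} {μ' : Y}
    (h : ∀ τ ≥ t, f' (u τ) + ContinuousLinearMap.adjoint A (μ τ) + ε τ • u τ = 0)
    (h' : ∀ τ ≥ t, A (u τ) - b - ε τ • μ τ = 0)
    (hu : HasDerivAt u u' t) (hμ : HasDerivAt μ μ' t) :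
    ‖u'‖ ^ 2 + ‖μ'‖ ^ 2 ≤ r ^ 2 * (‖u t‖ ^ 2 + ‖μ t‖ ^ 2) := by
  have key := inner_deriv_add_inner_deriv_nonpos (hε.smul hu) hu (hε.smul hμ) hμ (by
    intro τ hτ
    have h1 := hconv.add_inner_le_of_hasGradientAt (hf (u τ)) (u t)
    have h2 := hconv.add_inner_le_of_hasGradientAt (hf (u t)) (u τ)
    have e1 : f' (u τ) = -(ContinuousLinearMap.adjoint A (μ τ)) - ε τ • u τ := by
      rw [← sub_eq_zero, ← h τ hτ.le]; abel
    have e2 : f' (u t) = -(ContinuousLinearMap.adjoint A (μ t)) - ε t • u t := by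
      rw [← sub_eq_zero, ← h t le_rfl]; abel
    have e3 : A (u τ) = b + ε τ • μ τ := by rw [← sub_eq_zero, ← h' τ hτ.le]; abel
    have e4 : A (u t) = b + ε t • μ t := by rw [← sub_eq_zero, ← h' t le_rfl]; abel
    rw [e1] at h1
    rw [e2] at h2
    simp only [inner_sub_left, inner_sub_right, inner_neg_left, inner_add_right,
      ContinuousLinearMap.adjoint_inner_left, e3, e4, Pi.smul_apply'] at h1 h2 ⊢
    simp only [inner_smul_left, inner_smul_right, conj_trivial] at h1 h2 ⊢
    rw [real_inner_comm (μ t) (μ τ)] at *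
    linarith)
  simp only [inner_add_left, inner_smul_left, conj_trivial, real_inner_self_eq_norm_sq] at key
  have h1 := norm_sub_sq_real u' (r • u t)
  have h2 := norm_sub_sq_real μ' (r • μ t)
  rw [inner_smul_right, norm_smul, mul_pow, Real.norm_eq_abs, sq_abs, real_inner_comm] at h1 h2
  have h3 : ε t * (‖u'‖ ^ 2 + ‖μ'‖ ^ 2 - r * (⟪u t, u'⟫ + ⟪μ t, μ'⟫)) ≤ ε t * 0 := by linarith
  have h4 := le_of_mul_le_mul_left h3 hεt
  nlinarith [sq_nonneg ‖u' - r • u t‖, sq_nonneg ‖μ' - r • μ t‖]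

end SaddlePath

section Energy

variable {X Y : Type*} [NormedAddCommGroup X] [InnerProductSpace ℝ X] [CompleteSpace X]
  [NormedAddCommGroup Y] [InnerProductSpace ℝ Y] [CompleteSpace Y]
  {f : X → ℝ} {f' : X → X} {A : X →L[ℝ] Y} {b : Y}

/-- Derivative of the regularized Lagrangian gap along a trajectory. -/
theorem hasDerivAt_regularized_gap (hf : ∀ u, HasGradientAt f (f' u) u)
    {x xt : ℝ → X} {lt : ℝ → Y} {ε : ℝ → ℝ} {w a : X} {d : Y} {ε' t : ℝ}
    (hx : HasDerivAt x w t) (hxt : HasDerivAt xt a t) (hlt : HasDerivAt lt d t)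
    (hε : HasDerivAt ε ε' t)
    (h0 : f' (xt t) + ContinuousLinearMap.adjoint A (lt t) + ε t • xt t = 0) :
    HasDerivAt (fun τ => f (x τ) - f (xt τ) + ⟪lt τ, A (x τ - xt τ)⟫
        + ε τ / 2 * (‖x τ‖ ^ 2 - ‖xt τ‖ ^ 2))
      (⟪f' (x t) + ContinuousLinearMap.adjoint A (lt t) + ε t • x t, w⟫
        + ⟪d, A (x t - xt t)⟫ + ε' / 2 * (‖x t‖ ^ 2 - ‖xt t‖ ^ 2)) t := by
  have h1 : HasDerivAt (f ∘ x) ⟪f' (x t), w⟫ t := by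
    simpa using (hf (x t)).hasFDerivAt.comp_hasDerivAt t hx
  have h2 : HasDerivAt (f ∘ xt) ⟪f' (xt t), a⟫ t := by
    simpa using (hf (xt t)).hasFDerivAt.comp_hasDerivAt t hxt
  have h3 : HasDerivAt (fun τ => A (x τ - xt τ)) (A (w - a)) t :=
    A.hasFDerivAt.comp_hasDerivAt t (hx.sub hxt)
  refine (((h1.sub h2).add (hlt.inner ℝ h3)).add
    ((hε.div_const 2).mul (hx.norm_sq.sub hxt.norm_sq))).congr_deriv ?_
  have h4 : ⟪f' (xt t) + ContinuousLinearMap.adjoint A (lt t) + ε t • xt t, a⟫ = 0 := by simp [h0]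
  simp only [inner_add_left, inner_smul_left, conj_trivial,
    ContinuousLinearMap.adjoint_inner_left, map_sub, inner_sub_right, Pi.sub_apply] at h4 ⊢
  linarith

/-- Derivative of the Lyapunov energy along a trajectory of the primal-dual system. -/
theorem hasDerivAt_energy (hf : ∀ u, HasGradientAt f (f' u) u)
    {x x' xt : ℝ → X} {lam lt : ℝ → Y} {G : ℝ → X} {ε P Γ Θ σ : ℝ → ℝ}
    {x'' G' a : X} {lam' d : Y} {r κ B α t ε' P' Γ' Θ' σ' : ℝ}
    (hx : HasDerivAt x (x' t) t) (hx' : HasDerivAt x' x'' t) (hG : HasDerivAt G G' t)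
    (hlam : HasDerivAt lam lam' t) (hxt : HasDerivAt xt a t) (hlt : HasDerivAt lt d t)
    (hε : HasDerivAt ε ε' t) (hP : HasDerivAt P P' t) (hΓ : HasDerivAt Γ Γ' t)
    (hΘ : HasDerivAt Θ Θ' t) (hσ : HasDerivAt σ σ' t)
    (hα : α = r + 1) (hB : B = κ - Γ') (hσP : σ t = 1 - P') (hΘt : Θ t = P t * B + Γ t * σ t)
    (h0 : f' (xt t) + ContinuousLinearMap.adjoint A (lt t) + ε t • xt t = 0)
    (h0' : A (xt t) - b - ε t • lt t = 0)
    (hGt : G t = f' (x t) + ContinuousLinearMap.adjoint A (lam t) + ε t • x t)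
    (hode : P t • x'' + α • x' t + Γ t • G' + κ • G t = 0)
    (hode' : lam' = (r * B) • (A (x t) - b - ε t • lam t) + Θ t • A (x' t)) :
    HasDerivAt (fun τ => Θ τ * (f (x τ) - f (xt τ) + ⟪lt τ, A (x τ - xt τ)⟫
          + ε τ / 2 * (‖x τ‖ ^ 2 - ‖xt τ‖ ^ 2))
        + 1 / 2 * ‖r • (x τ - xt τ) + P τ • x' τ + Γ τ • G τ‖ ^ 2
        + r / 2 * (σ τ * ‖x τ - xt τ‖ ^ 2) + 1 / 2 * ‖lam τ - lt τ‖ ^ 2)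
      (Θ' * (f (x t) - f (xt t) + ⟪lt t, A (x t - xt t)⟫
          + ε t / 2 * (‖x t‖ ^ 2 - ‖xt t‖ ^ 2))
        + Θ t * (⟪d, A (x t - xt t)⟫ + ε' / 2 * (‖x t‖ ^ 2 - ‖xt t‖ ^ 2))
        - r * B * ⟪f' (x t) + ContinuousLinearMap.adjoint A (lt t) + ε t • x t, x t - xt t⟫
        - P t * σ t * ‖x' t‖ ^ 2 - Γ t * B * ‖G t‖ ^ 2 - r * B * ε t * ‖lam t - lt t‖ ^ 2
        + r / 2 * σ' * ‖x t - xt t‖ ^ 2 - r * σ t * ⟪x t - xt t, a⟫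
        - r * ⟪r • (x t - xt t) + P t • x' t + Γ t • G t, a⟫ - ⟪lam t - lt t, d⟫) t := by
  have hv := (((hx.sub hxt).const_smul r).add (hP.smul hx')).add (hΓ.smul hG)
  have hv' : r • (x' t - a) + (P t • x'' + P' • x' t) + (Γ t • G' + Γ' • G t)
      = -(σ t • x' t) - B • G t - r • a := by
    have e : P t • x'' = -(α • x' t) - Γ t • G' - κ • G t := by
      rw [← sub_eq_zero, ← hode]; abel
    rw [e, hσP, hB, hα]
    module
  rw [hv'] at hv
  have he := (hx.sub hxt).norm_sq
  have hη := (hlam.sub hlt).norm_sq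
  have hlam' : lam' = (r * B) • (A (x t - xt t) - ε t • (lam t - lt t)) + Θ t • A (x' t) := by
    have e : b = A (xt t) - ε t • lt t := by rw [← sub_eq_zero, ← neg_eq_zero, ← h0']; abel
    rw [hode', e, map_sub]
    module
  have hG2 : G t = f' (x t) + ContinuousLinearMap.adjoint A (lt t) + ε t • x t
      + ContinuousLinearMap.adjoint A (lam t - lt t) := by
    rw [hGt, map_sub]; abel
  refine ((((hΘ.mul (hasDerivAt_regularized_gap hf hx hxt hlt hε h0)).add
    (hv.norm_sq.const_mul (1 / 2))).add ((hσ.mul he).const_mul (r / 2))).add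
    (hη.const_mul (1 / 2))).congr_deriv ?_
  simp only [Pi.sub_apply, Pi.add_apply, Pi.smul_apply, Pi.smul_apply']
  rw [hlam']
  generalize f' (x t) + ContinuousLinearMap.adjoint A (lt t) + ε t • x t = h at hG2 ⊢
  generalize x t - xt t = e at hG2 ⊢
  generalize lam t - lt t = η at hG2 ⊢
  have i1 : ⟪G t, e⟫ = ⟪h, e⟫ + ⟪η, A e⟫ := by
    rw [hG2, inner_add_left, ContinuousLinearMap.adjoint_inner_left]
  have i2 : ⟪G t, x' t⟫ = ⟪h, x' t⟫ + ⟪η, A (x' t)⟫ := by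
    rw [hG2, inner_add_left, ContinuousLinearMap.adjoint_inner_left]
  simp only [inner_add_left, inner_add_right, inner_sub_right, inner_smul_left, inner_smul_right,
    inner_neg_right, conj_trivial, real_inner_self_eq_norm_sq]
  rw [real_inner_comm (G t) e, real_inner_comm (G t) (x' t), i1, i2, hΘt]
  ring

end Energy

theorem mul_le_mul_sq_add_of_sq_le {y n q z : ℝ} (hq : 0 < q) (h : y ^ 2 ≤ 4 * q * z) :
    y * n ≤ q * n ^ 2 + z := by
  have : 4 * q * (y * n) ≤ 4 * q * (q * n ^ 2 + z) := by nlinarith [sq_nonneg (2 * q * n - y)]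
  exact le_of_mul_le_mul_left this (by positivity)

theorem norm_add_add_sq_le {X : Type*} [SeminormedAddCommGroup X] (u v w : X) :
    ‖u + v + w‖ ^ 2 ≤ 3 * (‖u‖ ^ 2 + ‖v‖ ^ 2 + ‖w‖ ^ 2) := by
  have h := norm_add₃_le (a := u) (b := v) (c := w)
  have h2 : ‖u + v + w‖ ^ 2 ≤ (‖u‖ + ‖v‖ + ‖w‖) ^ 2 := by gcongr
  nlinarith [sq_nonneg (‖u‖ - ‖v‖), sq_nonneg (‖u‖ - ‖w‖), sq_nonneg (‖v‖ - ‖w‖)]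

/-- Pointwise differential inequality for the Lyapunov energy: the expression on the left is the
derivative of the energy, the first factor on the right is minus the energy. -/
theorem energy_deriv_le {X Y : Type*} [NormedAddCommGroup X] [InnerProductSpace ℝ X]
    [NormedAddCommGroup Y] [InnerProductSpace ℝ Y] (A : X →L[ℝ] Y)
    {e w G a : X} {η d : Y} {r δ τ ε κ P Γ σ σ' Θ Θ' B N k k' γ p D J n : ℝ}
    (hr : 0 < r) (hδ : 0 < δ) (hτ : 0 < τ) (hε : 0 < ε) (hκ : 1 ≤ κ) (hP : 0 < P)
    (hγ : 0 < γ) (hγΓ : γ ≤ Γ) (hΓP : Γ ≤ P * κ) (hPk : P ≤ k) (hσ1 : 1 / 2 ≤ σ) (hσ2 : σ ≤ 3 / 2)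
    (hB : κ / 2 ≤ B) (hΘ0 : 0 ≤ Θ) (hΘ : Θ ≤ 5 / 2 * (P * κ))
    (hD : Θ' + δ * Θ ≤ r * B) (hw : 6 * k * δ ≤ 1) (hg : 6 * (δ * Γ) ≤ κ)
    (he : r / 2 * |σ'| + 3 / 2 * δ * r ^ 2 + 3 / 4 * δ * r ≤ r * κ * ε / 8)
    (hη : δ / 2 ≤ r * κ * ε / 4) (hk' : τ ≤ k' * ε ^ 2) (hτκ : τ ≤ κ * ε)
    (hp0 : 0 ≤ p) (hp1 : p ≤ 1) (hN : 0 ≤ N) (ha : ‖a‖ ≤ N * τ) (hd : ‖d‖ ≤ N * τ)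
    (hD0 : 0 ≤ D) (hJ : D + ε / 2 * ‖e‖ ^ 2 ≤ J) (hn : -N ^ 2 ≤ n) :
    Θ' * D + Θ * (⟪d, A e⟫ + -(p * τ * ε) / 2 * n) - r * B * J - P * σ * ‖w‖ ^ 2
        - Γ * B * ‖G‖ ^ 2 - r * B * ε * ‖η‖ ^ 2 + r / 2 * σ' * ‖e‖ ^ 2 - r * σ * ⟪e, a⟫
        - r * ⟪r • e + P • w + Γ • G, a⟫ - ⟪η, d⟫
      ≤ -δ * (Θ * D + 1 / 2 * ‖r • e + P • w + Γ • G‖ ^ 2 + r / 2 * (σ * ‖e‖ ^ 2)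
          + 1 / 2 * ‖η‖ ^ 2)
        + (2 * r ^ 2 * N ^ 2 + 25 * ‖A‖ ^ 2 * N ^ 2 * k * k' / r
            + 4 * (3 / 2 * r + r ^ 2) ^ 2 * N ^ 2 * k' / (r * γ) + N ^ 2 * k' / (r * γ)
            + 5 / 4 * N ^ 2) * (P * κ * ε * τ) := by
  have hΓ : 0 < Γ := hγ.trans_le hγΓ
  have hκ0 : 0 < κ := one_pos.trans_le hκ
  have hB0 : 0 < B := by linarith
  have hk : 0 < k := hP.trans_le hPk
  have hk'0 : 0 < k' := by
    by_contra! h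
    have : k' * ε ^ 2 ≤ 0 := mul_nonpos_of_nonpos_of_nonneg h (by positivity)
    linarith
  have hNτ : 0 ≤ N * τ := by positivity
  have hv := norm_add_add_sq_le (r • e) (P • w) (Γ • G)
  simp only [norm_smul, mul_pow, Real.norm_eq_abs, sq_abs] at hv
  -- inner product bounds
  have b1 : ⟪d, A e⟫ ≤ ‖A‖ * (N * τ) * ‖e‖ := by
    calc ⟪d, A e⟫ ≤ ‖d‖ * ‖A e‖ := real_inner_le_norm _ _
      _ ≤ (N * τ) * (‖A‖ * ‖e‖) := by gcongr; exact A.le_opNorm e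
      _ = _ := by ring
  have b2 (u : X) : -⟪u, a⟫ ≤ ‖u‖ * (N * τ) := by
    rw [← inner_neg_left]
    calc ⟪-u, a⟫ ≤ ‖-u‖ * ‖a‖ := real_inner_le_norm _ _
      _ ≤ ‖u‖ * (N * τ) := by rw [norm_neg]; gcongr
  have b3 : -⟪η, d⟫ ≤ ‖η‖ * (N * τ) := by
    rw [← inner_neg_left]
    calc ⟪-η, d⟫ ≤ ‖-η‖ * ‖d‖ := real_inner_le_norm _ _
      _ ≤ ‖η‖ * (N * τ) := by rw [norm_neg]; gcongr
  have hvi : ⟪r • e + P • w + Γ • G, a⟫ = r * ⟪e, a⟫ + P * ⟪w, a⟫ + Γ * ⟪G, a⟫ := by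
    simp only [inner_add_left, inner_smul_left, conj_trivial]
  -- Young inequalities
  have hγU : γ ≤ P * κ := hγΓ.trans hΓP
  have y1 : 5 / 2 * (P * κ) * ‖A‖ * (N * τ) * ‖e‖ ≤ r * κ * ε / 16 * ‖e‖ ^ 2
      + 25 * ‖A‖ ^ 2 * N ^ 2 * k * k' / r * (P * κ * ε * τ) := by
    apply mul_le_mul_sq_add_of_sq_le (by positivity)
    have h1 : P * τ ≤ k * (k' * ε ^ 2) := by gcongr
    calc (5 / 2 * (P * κ) * ‖A‖ * (N * τ)) ^ 2
        = 25 / 4 * ‖A‖ ^ 2 * N ^ 2 * P * κ ^ 2 * τ * (P * τ) := by ring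
      _ ≤ 25 / 4 * ‖A‖ ^ 2 * N ^ 2 * P * κ ^ 2 * τ * (k * (k' * ε ^ 2)) := by gcongr
      _ = _ := by field_simp; ring
  have h1 : τ ≤ k' * ε ^ 2 * κ * (P * κ / γ) := by
    have : 1 ≤ P * κ / γ := (one_le_div hγ).2 hγU
    calc τ ≤ k' * ε ^ 2 * 1 * 1 := by linarith
      _ ≤ _ := by gcongr
  have y2 : (3 / 2 * r + r ^ 2) * (N * τ) * ‖e‖ ≤ r * κ * ε / 16 * ‖e‖ ^ 2
      + 4 * (3 / 2 * r + r ^ 2) ^ 2 * N ^ 2 * k' / (r * γ) * (P * κ * ε * τ) := by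
    apply mul_le_mul_sq_add_of_sq_le (by positivity)
    calc ((3 / 2 * r + r ^ 2) * (N * τ)) ^ 2
        = (3 / 2 * r + r ^ 2) ^ 2 * N ^ 2 * τ * τ := by ring
      _ ≤ (3 / 2 * r + r ^ 2) ^ 2 * N ^ 2 * τ * (k' * ε ^ 2 * κ * (P * κ / γ)) := by gcongr
      _ = _ := by field_simp; ring
  have y3 : (N * τ) * ‖η‖ ≤ r * κ * ε / 4 * ‖η‖ ^ 2
      + N ^ 2 * k' / (r * γ) * (P * κ * ε * τ) := by
    apply mul_le_mul_sq_add_of_sq_le (by positivity)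
    calc (N * τ) ^ 2 = N ^ 2 * τ * τ := by ring
      _ ≤ N ^ 2 * τ * (k' * ε ^ 2 * κ * (P * κ / γ)) := by gcongr
      _ = _ := by field_simp
  have h2 : P * τ ^ 2 ≤ P * κ * ε * τ := by
    calc P * τ ^ 2 = P * τ * τ := by ring
      _ ≤ P * τ * (κ * ε) := by gcongr
      _ = _ := by ring
  have y4 : r * P * (N * τ) * ‖w‖ ≤ P / 4 * ‖w‖ ^ 2 + r ^ 2 * N ^ 2 * (P * κ * ε * τ) := by
    apply mul_le_mul_sq_add_of_sq_le (by positivity)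
    calc (r * P * (N * τ)) ^ 2 = P * r ^ 2 * N ^ 2 * (P * τ ^ 2) := by ring
      _ ≤ P * r ^ 2 * N ^ 2 * (P * κ * ε * τ) := by gcongr
      _ = _ := by ring
  have y5 : r * Γ * (N * τ) * ‖G‖ ≤ Γ * κ / 4 * ‖G‖ ^ 2 + r ^ 2 * N ^ 2 * (P * κ * ε * τ) := by
    apply mul_le_mul_sq_add_of_sq_le (by positivity)
    calc (r * Γ * (N * τ)) ^ 2 = r ^ 2 * N ^ 2 * τ ^ 2 * Γ * Γ := by ring
      _ ≤ r ^ 2 * N ^ 2 * τ ^ 2 * Γ * (P * κ) := by gcongr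
      _ = Γ * κ * r ^ 2 * N ^ 2 * (P * τ ^ 2) := by ring
      _ ≤ Γ * κ * r ^ 2 * N ^ 2 * (P * κ * ε * τ) := by gcongr
      _ = _ := by ring
  -- the individual terms
  have t1 : Θ' * D + δ * (Θ * D) ≤ r * B * D := by
    calc _ = (Θ' + δ * Θ) * D := by ring
      _ ≤ _ := by gcongr
  have t2 : r * B * (D + ε / 2 * ‖e‖ ^ 2) ≤ r * B * J := by gcongr
  have t2' : r * (κ / 2) * (ε / 2 * ‖e‖ ^ 2) ≤ r * B * (ε / 2 * ‖e‖ ^ 2) := by gcongr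
  have t3 : Θ * ⟪d, A e⟫ ≤ 5 / 2 * (P * κ) * ‖A‖ * (N * τ) * ‖e‖ := by
    calc Θ * ⟪d, A e⟫ ≤ Θ * (‖A‖ * (N * τ) * ‖e‖) := by gcongr
      _ ≤ 5 / 2 * (P * κ) * (‖A‖ * (N * τ) * ‖e‖) := by gcongr
      _ = _ := by ring
  have t4 : Θ * (-(p * τ * ε) / 2 * n) ≤ 5 / 4 * N ^ 2 * (P * κ * ε * τ) := by
    calc Θ * (-(p * τ * ε) / 2 * n) = Θ * (p * (τ * ε) / 2) * (-n) := by ring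
      _ ≤ Θ * (p * (τ * ε) / 2) * N ^ 2 := by gcongr; linarith
      _ ≤ 5 / 2 * (P * κ) * (1 * (τ * ε) / 2) * N ^ 2 := by gcongr
      _ = _ := by ring
  have t5 : P * (1 / 2) * ‖w‖ ^ 2 ≤ P * σ * ‖w‖ ^ 2 := by gcongr
  have t6 : Γ * (κ / 2) * ‖G‖ ^ 2 ≤ Γ * B * ‖G‖ ^ 2 := by gcongr
  have t7 : r * (κ / 2) * ε * ‖η‖ ^ 2 ≤ r * B * ε * ‖η‖ ^ 2 := by gcongr
  have t8 : r / 2 * σ' * ‖e‖ ^ 2 ≤ r / 2 * |σ'| * ‖e‖ ^ 2 := by gcongr; exact le_abs_self _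
  have t9 : (r * σ + r ^ 2) * -⟪e, a⟫ ≤ (3 / 2 * r + r ^ 2) * (N * τ) * ‖e‖ := by
    calc (r * σ + r ^ 2) * -⟪e, a⟫ ≤ (r * σ + r ^ 2) * (‖e‖ * (N * τ)) := by
          gcongr; exact b2 e
      _ ≤ (r * (3 / 2) + r ^ 2) * (‖e‖ * (N * τ)) := by gcongr
      _ = _ := by ring
  have t10 : r * P * -⟪w, a⟫ ≤ r * P * (‖w‖ * (N * τ)) := by gcongr; exact b2 w
  have t11 : r * Γ * -⟪G, a⟫ ≤ r * Γ * (‖G‖ * (N * τ)) := by gcongr; exact b2 G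
  have s1 : δ * (1 / 2 * ‖r • e + P • w + Γ • G‖ ^ 2)
      ≤ δ * (1 / 2 * (3 * (r ^ 2 * ‖e‖ ^ 2 + P ^ 2 * ‖w‖ ^ 2 + Γ ^ 2 * ‖G‖ ^ 2))) := by gcongr
  have s2 : δ * P ^ 2 * ‖w‖ ^ 2 * 6 ≤ P * ‖w‖ ^ 2 := by
    calc δ * P ^ 2 * ‖w‖ ^ 2 * 6 = 6 * P * δ * (P * ‖w‖ ^ 2) := by ring
      _ ≤ 6 * k * δ * (P * ‖w‖ ^ 2) := by gcongr
      _ ≤ 1 * (P * ‖w‖ ^ 2) := by gcongr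
      _ = _ := by ring
  have s3 : δ * Γ ^ 2 * ‖G‖ ^ 2 * 6 ≤ Γ * κ * ‖G‖ ^ 2 := by
    calc δ * Γ ^ 2 * ‖G‖ ^ 2 * 6 = 6 * (δ * Γ) * (Γ * ‖G‖ ^ 2) := by ring
      _ ≤ κ * (Γ * ‖G‖ ^ 2) := by gcongr
      _ = _ := by ring
  have s4 : δ * (r / 2 * (σ * ‖e‖ ^ 2)) ≤ δ * (r / 2 * (3 / 2 * ‖e‖ ^ 2)) := by gcongr
  have s5 : (r / 2 * |σ'| + 3 / 2 * δ * r ^ 2 + 3 / 4 * δ * r) * ‖e‖ ^ 2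
      ≤ r * κ * ε / 8 * ‖e‖ ^ 2 := by gcongr
  have s6 : δ / 2 * ‖η‖ ^ 2 ≤ r * κ * ε / 4 * ‖η‖ ^ 2 := by gcongr
  rw [hvi]
  linarith
theorem eventually_const_mul_rpow_le (C : ℝ) {a b : ℝ} (hab : a < b) :
    ∀ᶠ t : ℝ in atTop, C * t ^ a ≤ t ^ b := by
  filter_upwards [(tendsto_rpow_atTop (sub_pos.2 hab)).eventually_ge_atTop C,
    eventually_gt_atTop 0] with t ht ht0
  calc C * t ^ a ≤ t ^ (b - a) * t ^ a := by gcongr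
    _ = t ^ b := by rw [← rpow_add ht0, sub_add_cancel]

/-- Bounds on the potential coefficient `P B + Γ (1 - P')` of the energy and its derivative. -/
theorem potential_coeff_bounds {P P' P'' Γ B B' κ τ k K q : ℝ} (hP : 0 < P) (hPk : P ≤ k)
    (hκ : 0 < κ) (hΓ : 0 < Γ) (hΓP : Γ ≤ P * κ) (hτ : 0 < τ) (hq1 : q ≤ 1)
    (hP' : |P'| ≤ K * P * τ) (hP'' : |P''| ≤ K * P * τ ^ 2) (hB' : |B'| ≤ K * κ * τ)
    (hB1 : κ / 2 ≤ B) (hB2 : B ≤ κ) (hK : 0 ≤ K) (hKk : K * k * τ ≤ 1 / 2) :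
    1 / 2 ≤ 1 - P' ∧ 1 - P' ≤ 3 / 2 ∧ P * κ / 2 ≤ P * B + Γ * (1 - P') ∧
      P * B + Γ * (1 - P') ≤ 5 / 2 * (P * κ) ∧
      P' * B + P * B' + (q * Γ * τ * (1 - P') + Γ * -P'') ≤ (2 * K + 2) * (P * κ * τ) := by
  have h1 : |P'| ≤ 1 / 2 := by
    calc |P'| ≤ K * P * τ := hP'
      _ ≤ K * k * τ := by gcongr
      _ ≤ _ := hKk
  obtain ⟨h2, h3⟩ := abs_le.1 h1
  have hσ0 : 0 < 1 - P' := by linarith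
  have hB0 : 0 < B := by linarith
  have e1 : P * (κ / 2) ≤ P * B := by gcongr
  have e2 : P * B ≤ P * κ := by gcongr
  have e3 : Γ * (1 - P') ≤ P * κ * (3 / 2) := by gcongr; linarith
  have e4 : 0 ≤ Γ * (1 - P') := by positivity
  refine ⟨by linarith, by linarith, by linarith, by linarith, ?_⟩
  have d1 : P' * B ≤ K * (P * κ * τ) := by
    calc P' * B ≤ |P'| * B := by gcongr; exact le_abs_self _
      _ ≤ (K * P * τ) * κ := by gcongr
      _ = _ := by ring
  have d2 : P * B' ≤ K * (P * κ * τ) := by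
    calc P * B' ≤ P * |B'| := by gcongr; exact le_abs_self _
      _ ≤ P * (K * κ * τ) := by gcongr
      _ = _ := by ring
  have d3 : q * Γ * τ * (1 - P') ≤ 3 / 2 * (P * κ * τ) := by
    calc q * Γ * τ * (1 - P') ≤ 1 * (P * κ) * τ * (3 / 2) := by gcongr; linarith
      _ = _ := by ring
  have d4 : Γ * -P'' ≤ 1 / 2 * (P * κ * τ) := by
    calc Γ * -P'' ≤ Γ * |P''| := by gcongr; exact neg_le_abs _
      _ ≤ (P * κ) * (K * P * τ ^ 2) := by gcongr
      _ = (P * κ) * τ * (K * P * τ) := by ring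
      _ ≤ (P * κ) * τ * (K * k * τ) := by gcongr
      _ ≤ (P * κ) * τ * (1 / 2) := by gcongr
      _ = _ := by ring
  linarith

set_option maxHeartbeats 2000000 in
theorem eventually_coeff_bounds {q s γ k₁ k₂ c p r t₀ T₁ T₂ ρ : ℝ} {m m' m'' : ℝ → ℝ}
    {P P' P'' B B' : ℝ → ℝ} (hq0 : 0 < q) (hq1 : q < 1) (hγ : 0 < γ) (hs : 0 < s)
    (hc : 0 < c) (hr : 0 < r) (hmpos : ∀ t ≥ t₀, 0 < m t) (hk₁ : 0 < k₁) (hk₂ : 0 < k₂)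
    (hA1 : ∀ t ≥ T₁, γ / t ^ (q + s) ≤ m t ∧ m t ≤ k₁ / t ^ q)
    (hA2 : ∀ t ≥ T₂, t * |m' t| ≤ k₂ * m t ∧ t ^ 2 * |m'' t| ≤ k₂ * m t)
    (hp2 : 2 * p < 1) (hp3 : p < 2 * q + s)
    (hP : ∀ t, P t = m t * t ^ q) (hP' : ∀ t, P' t = m' t * t ^ q + m t * (q * t ^ (q - 1)))
    (hP'' : ∀ t, P'' t = m'' t * t ^ q + m' t * (q * t ^ (q - 1))
      + (m' t * (q * t ^ (q - 1)) + m t * (q * ((q - 1) * t ^ (q - 1 - 1)))))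
    (hB : ∀ t, B t = t ^ (q + s) - γ * q * t ^ (q - 1))
    (hB' : ∀ t, B' t = (q + s) * t ^ (q + s - 1) - γ * q * ((q - 1) * t ^ (q - 1 - 1))) :
    ∀ᶠ t in atTop, t₀ ≤ t ∧ 1 ≤ t ∧ (1 ≤ t ^ (q + s) ∧ 0 < P t ∧ P t ≤ k₁ ∧
      γ ≤ γ * t ^ q ∧ γ * t ^ q ≤ P t * t ^ (q + s)) ∧
      (1 / 2 ≤ 1 - P' t ∧ 1 - P' t ≤ 3 / 2 ∧ t ^ (q + s) / 2 ≤ B t ∧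
      P t * t ^ (q + s) / 2 ≤ P t * B t + γ * t ^ q * (1 - P' t) ∧
      P t * B t + γ * t ^ q * (1 - P' t) ≤ 5 / 2 * (P t * t ^ (q + s))) ∧
      (P' t * B t + P t * B' t + (q * (γ * t ^ q) * t⁻¹ * (1 - P' t) + γ * t ^ q * -P'' t)
        + t ^ (-q) * (P t * B t + γ * t ^ q * (1 - P' t)) ≤ r * B t) ∧
      6 * k₁ * t ^ (-q) ≤ 1 ∧ 6 * (t ^ (-q) * (γ * t ^ q)) ≤ t ^ (q + s) ∧
      r / 2 * |-P'' t| + 3 / 2 * t ^ (-q) * r ^ 2 + 3 / 4 * t ^ (-q) * r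
        ≤ r * t ^ (q + s) * (c / t ^ p) / 8 ∧
      t ^ (-q) / 2 ≤ r * t ^ (q + s) * (c / t ^ p) / 4 ∧
      t⁻¹ ≤ 1 / c ^ 2 * (c / t ^ p) ^ 2 ∧ t⁻¹ ≤ t ^ (q + s) * (c / t ^ p) ∧ t⁻¹ ≤ t ^ (-q) ∧
      -(t ^ (-q) / 2 * (m t * t ^ ρ)) ≤ m' t * t ^ ρ + m t * (ρ * t ^ (ρ - 1)) := by
  set K : ℝ := 3 * k₂ + q + s + 1 with hKdef
  set C : ℝ := (r / 2 * (K * k₁) + 3 / 2 * r ^ 2 + 3 / 4 * r) * (8 / r) + 2 / r + 1 with hCdef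
  have hK : 0 < K := by positivity
  filter_upwards [eventually_ge_atTop t₀, eventually_ge_atTop 1, eventually_ge_atTop T₁,
    eventually_ge_atTop T₂, eventually_const_mul_rpow_le (6 * k₁) (neg_lt_zero.2 hq0),
    eventually_const_mul_rpow_le (2 * (K * k₁)) (neg_lt_zero.2 hq0),
    eventually_const_mul_rpow_le (2 / r * ((2 * K + 2) * k₁ + 5 / 2 * k₁)) (neg_lt_zero.2 hq0),
    eventually_const_mul_rpow_le (6 * γ) (show 0 < q + s by positivity),
    eventually_const_mul_rpow_le (C / c) (show -q < q + s + -p by linarith),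
    eventually_const_mul_rpow_le (2 * (k₂ + |ρ|)) (show -1 < -q by linarith)]
    with t ht0 ht1 htT₁ htT₂ g1 g2 g3 g4 g5 g6
  have ht : 0 < t := one_pos.trans_le ht1
  rw [rpow_zero] at g1 g2 g3
  rw [rpow_zero, mul_one] at g4
  rw [rpow_neg_one] at g6
  obtain ⟨a1, a2⟩ := hA1 t htT₁
  obtain ⟨a3, a4⟩ := hA2 t htT₂
  have hm := hmpos t ht0
  have e1 : t ^ (q - 1) = t ^ q * t⁻¹ := by rw [rpow_sub_one ht.ne', div_eq_mul_inv]
  have e2 : t ^ (q - 1 - 1) = t ^ q * t⁻¹ ^ 2 := by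
    rw [rpow_sub_one ht.ne', e1, div_eq_mul_inv]; ring
  have e3 : t ^ (q + s - 1) = t ^ (q + s) * t⁻¹ := by rw [rpow_sub_one ht.ne', div_eq_mul_inv]
  have e4 : t ^ (ρ - 1) = t ^ ρ * t⁻¹ := by rw [rpow_sub_one ht.ne', div_eq_mul_inv]
  have e5 : c / t ^ p = c * t ^ (-p) := by rw [rpow_neg ht.le, div_eq_mul_inv]
  have hP0 : 0 < P t := by rw [hP]; positivity
  have hκ1 : 1 ≤ t ^ (q + s) := one_le_rpow ht1 (by positivity)
  have hτδ : t⁻¹ ≤ t ^ (-q) := by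
    rw [← rpow_neg_one]; exact rpow_le_rpow_of_exponent_le ht1 (by linarith)
  have hΓ1 : 1 ≤ t ^ q := one_le_rpow ht1 hq0.le
  have hΓP : γ * t ^ q ≤ P t * t ^ (q + s) := by
    rw [div_le_iff₀ (by positivity)] at a1
    rw [hP]
    calc γ * t ^ q ≤ m t * t ^ (q + s) * t ^ q := by gcongr
      _ = _ := by ring
  have hPk : P t ≤ k₁ := by rw [hP]; rwa [le_div_iff₀ (by positivity)] at a2
  have hδq : t ^ (-q) * t ^ q = 1 := by rw [← rpow_add ht, neg_add_cancel, rpow_zero]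
  have hκδ : C * t ^ (-q) ≤ t ^ (q + s) * (c * t ^ (-p)) := by
    rw [rpow_add ht, div_mul_eq_mul_div, div_le_iff₀ hc] at g5
    linarith
  have hτ1 : t⁻¹ ≤ 1 := inv_le_one_of_one_le₀ ht1
  have hΓτ : γ * t ^ q * t⁻¹ ≤ t ^ (q + s) / 6 := by
    have : t ^ q * t⁻¹ ≤ 1 := by
      rw [← e1]; exact rpow_le_one_of_one_le_of_nonpos ht1 (by linarith)
    calc γ * t ^ q * t⁻¹ = γ * (t ^ q * t⁻¹) := by ring
      _ ≤ γ * 1 := by gcongr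
      _ ≤ _ := by linarith
  have b3 : |m' t| ≤ k₂ * m t * t⁻¹ := by
    rw [← div_eq_mul_inv, le_div_iff₀ ht]; linarith
  have b4 : |m'' t| ≤ k₂ * m t * t⁻¹ ^ 2 := by
    rw [inv_pow, ← div_eq_mul_inv, le_div_iff₀ (by positivity)]; linarith
  have hδ0 : 0 < t ^ (-q) := by positivity
  replace hB := hB t
  replace hB' := hB' t
  rw [e1] at hB
  rw [e2, e3] at hB'
  clear a1 e3 g5
  rw [e5]
  generalize t ^ (-q) = δ at *
  generalize t ^ (q + s) = κ at *
  have hω0 : 0 < t ^ (-p) := by positivity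
  have hω : t⁻¹ ≤ (t ^ (-p)) ^ 2 := by
    rw [← rpow_natCast, ← rpow_mul ht.le, ← rpow_neg_one]
    refine rpow_le_rpow_of_exponent_le ht1 ?_
    push_cast; linarith
  generalize t ^ (-p) = ω at *
  have hκ0 : 0 < κ := one_pos.trans_le hκ1
  have hτ0 : 0 < t⁻¹ := by positivity
  have bP' : |P' t| ≤ K * P t * t⁻¹ := by
    rw [hP', e1, hP]
    calc |m' t * t ^ q + m t * (q * (t ^ q * t⁻¹))|
        ≤ |m' t * t ^ q| + |m t * (q * (t ^ q * t⁻¹))| := abs_add_le _ _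
      _ = |m' t| * t ^ q + m t * (q * (t ^ q * t⁻¹)) := by
          rw [abs_mul, abs_of_pos (by positivity : 0 < t ^ q),
            abs_of_pos (by positivity : 0 < m t * (q * (t ^ q * t⁻¹)))]
      _ ≤ k₂ * m t * t⁻¹ * t ^ q + m t * (q * (t ^ q * t⁻¹)) := by gcongr
      _ = (k₂ + q) * (m t * t ^ q) * t⁻¹ := by ring
      _ ≤ K * (m t * t ^ q) * t⁻¹ := by gcongr; linarith
  have bP'' : |P'' t| ≤ K * P t * t⁻¹ ^ 2 := by
    rw [hP'', e1, e2, hP]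
    have x1 : |m'' t * t ^ q| ≤ k₂ * m t * t⁻¹ ^ 2 * t ^ q := by
      rw [abs_mul, abs_of_pos (by positivity : 0 < t ^ q)]; gcongr
    have x2 : |m' t * (q * (t ^ q * t⁻¹))| ≤ k₂ * m t * t⁻¹ * (1 * (t ^ q * t⁻¹)) := by
      rw [abs_mul, abs_of_pos (by positivity : 0 < q * (t ^ q * t⁻¹))]; gcongr
    have x3 : |m t * (q * ((q - 1) * (t ^ q * t⁻¹ ^ 2)))| ≤ m t * (1 * (1 * (t ^ q * t⁻¹ ^ 2))) := by
      rw [abs_mul, abs_of_pos hm, abs_mul, abs_of_pos hq0, abs_mul,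
        abs_of_pos (by positivity : 0 < t ^ q * t⁻¹ ^ 2)]
      gcongr
      rw [abs_le]; constructor <;> linarith
    have x4 : 3 * k₂ + 1 ≤ K := by linarith
    calc _ ≤ |m'' t * t ^ q| + |m' t * (q * (t ^ q * t⁻¹))| + (|m' t * (q * (t ^ q * t⁻¹))|
            + |m t * (q * ((q - 1) * (t ^ q * t⁻¹ ^ 2)))|) :=
          (abs_add_le _ _).trans (add_le_add (abs_add_le _ _) (abs_add_le _ _))
      _ ≤ (3 * k₂ + 1) * (m t * t ^ q) * t⁻¹ ^ 2 := by linarith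
      _ ≤ _ := by gcongr
  have bB' : |B' t| ≤ K * κ * t⁻¹ := by
    rw [hB']
    calc |(q + s) * (κ * t⁻¹) - γ * q * ((q - 1) * (t ^ q * t⁻¹ ^ 2))|
        = |(q + s) * (κ * t⁻¹) + q * (1 - q) * (γ * t ^ q * t⁻¹ * t⁻¹)| := by ring_nf
      _ = (q + s) * (κ * t⁻¹) + q * (1 - q) * (γ * t ^ q * t⁻¹ * t⁻¹) := by
          rw [abs_of_pos]
          have : 0 < 1 - q := by linarith
          positivity
      _ ≤ (q + s) * (κ * t⁻¹) + 1 * (κ / 6 * t⁻¹) := by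
          gcongr
          linarith [mul_pos hq0 hq0]
      _ ≤ (q + s + 1) * κ * t⁻¹ := by linarith [mul_pos hκ0 hτ0]
      _ ≤ _ := by gcongr; linarith
  have hB1 : κ / 2 ≤ B t := by
    rw [hB]
    have : q * (γ * t ^ q * t⁻¹) ≤ 1 * (κ / 6) := by gcongr
    linarith
  have hB2 : B t ≤ κ := by
    rw [hB]
    have : 0 ≤ γ * q * (t ^ q * t⁻¹) := by positivity
    linarith
  have hKτ : K * k₁ * t⁻¹ ≤ 1 / 2 := by
    have : K * k₁ * t⁻¹ ≤ K * k₁ * δ := by gcongr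
    linarith
  obtain ⟨o1, o2, o3, o4, o5⟩ := potential_coeff_bounds hP0 hPk hκ0 (by positivity) hΓP hτ0
    hq1.le bP' bP'' bB' hB1 hB2 hK.le hKτ
  have hδκ : δ ≤ κ * (c * ω) := by
    have : 1 * δ ≤ C * δ := by
      gcongr
      rw [hCdef]
      have : 0 ≤ (r / 2 * (K * k₁) + 3 / 2 * r ^ 2 + 3 / 4 * r) * (8 / r) + 2 / r := by positivity
      linarith
    linarith
  refine ⟨ht0, ht1, ⟨hκ1, hP0, hPk, le_mul_of_one_le_right hγ.le hΓ1, hΓP⟩,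
    ⟨o1, o2, hB1, o3, o4⟩, ?_, g1, ?_, ?_, ?_,
    ?_, hτδ.trans hδκ, hτδ, ?_⟩
  · have x1 : (2 * K + 2) * (P t * κ * t⁻¹) ≤ (2 * K + 2) * (k₁ * κ * δ) := by gcongr
    have x2 : δ * (P t * B t + γ * t ^ q * (1 - P' t)) ≤ δ * (5 / 2 * (k₁ * κ)) :=
      mul_le_mul_of_nonneg_left (o4.trans (by gcongr)) hδ0.le
    have x3 : (2 / r * ((2 * K + 2) * k₁ + 5 / 2 * k₁) * δ) * (r / 2 * κ) ≤ 1 * (r / 2 * κ) := by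
      gcongr
    have x4 : (2 / r * ((2 * K + 2) * k₁ + 5 / 2 * k₁) * δ) * (r / 2 * κ)
        = (2 * K + 2) * (k₁ * κ * δ) + δ * (5 / 2 * (k₁ * κ)) := by field_simp
    have x5 : r * (κ / 2) ≤ r * B t := by gcongr
    linarith
  · linear_combination 6 * γ * hδq + g4
  · rw [abs_neg]
    have x1 : |P'' t| ≤ K * k₁ * δ := by
      calc |P'' t| ≤ K * P t * t⁻¹ ^ 2 := bP''
        _ = K * P t * (t⁻¹ * t⁻¹) := by ring
        _ ≤ K * k₁ * (1 * δ) := by gcongr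
        _ = _ := by ring
    have x2 : r / 2 * |P'' t| ≤ r / 2 * (K * k₁ * δ) := by gcongr
    have x3 : r / 8 * (C * δ) ≤ r / 8 * (κ * (c * ω)) := by gcongr
    have x4 : r / 8 * (C * δ) = (r / 2 * (K * k₁) + 3 / 2 * r ^ 2 + 3 / 4 * r) * δ
        + δ / 4 + r / 8 * δ := by rw [hCdef]; field_simp; ring
    have x5 : 0 ≤ r / 8 * δ := by positivity
    linarith
  · have x3 : r / 4 * (C * δ) ≤ r / 4 * (κ * (c * ω)) := by gcongr
    have x4 : r / 4 * (C * δ) = 2 * ((r / 2 * (K * k₁) + 3 / 2 * r ^ 2 + 3 / 4 * r) * δ)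
        + δ / 2 + r / 4 * δ := by rw [hCdef]; field_simp; ring
    have x5 : 0 ≤ r / 4 * δ := by positivity
    have x6 : 0 ≤ (r / 2 * (K * k₁) + 3 / 2 * r ^ 2 + 3 / 4 * r) * δ := by positivity
    linarith
  · calc t⁻¹ ≤ ω ^ 2 := hω
      _ = _ := by field_simp
  · rw [e4]
    have hρ : 0 < t ^ ρ := by positivity
    have x1 : -(k₂ * m t * t⁻¹) ≤ m' t := (abs_le.1 b3).1
    have x2 : -|ρ| ≤ ρ := neg_abs_le ρ
    have x3 : (k₂ + |ρ|) * t⁻¹ * (m t * t ^ ρ) ≤ δ / 2 * (m t * t ^ ρ) := by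
      gcongr; linarith
    have x4 : -(k₂ * m t * t⁻¹) * t ^ ρ ≤ m' t * t ^ ρ := by gcongr
    have x5 : m t * (-|ρ| * (t ^ ρ * t⁻¹)) ≤ m t * (ρ * (t ^ ρ * t⁻¹)) := by gcongr
    linarith

/-- A function with `E' ≤ -δ E + C δ R` is bounded by a multiple of `R` when `R` decays at
relative rate at most `δ / 2`. -/
theorem exists_le_mul_of_deriv_le {E E' R R' δ : ℝ → ℝ} {T C : ℝ} (hC : 0 ≤ C)
    (hE : ∀ t ≥ T, HasDerivAt E (E' t) t) (hR : ∀ t ≥ T, HasDerivAt R (R' t) t)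
    (hδ : ∀ t ≥ T, 0 < δ t) (hR0 : ∀ t ≥ T, 0 < R t)
    (hR' : ∀ t ≥ T, -(δ t / 2 * R t) ≤ R' t)
    (hE' : ∀ t ≥ T, E' t ≤ -δ t * E t + C * (δ t * R t)) :
    ∃ M > 0, ∀ t ≥ T, E t ≤ M * R t := by
  refine ⟨max (2 * C + 1) (E T / R T), lt_max_of_lt_left (by positivity), fun t ht => ?_⟩
  set M := max (2 * C + 1) (E T / R T)
  have hM : 2 * C + 1 ≤ M := le_max_left _ _
  refine image_le_of_deriv_right_lt_deriv_boundary' (B := fun τ => M * R τ)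
    (B' := fun τ => M * R' τ) (a := T) (b := t)
    (fun τ hτ => (hE τ hτ.1).continuousAt.continuousWithinAt)
    (fun τ hτ => (hE τ hτ.1).hasDerivWithinAt) ?_
    (fun τ hτ => ((hR τ hτ.1).const_mul M).continuousAt.continuousWithinAt)
    (fun τ hτ => ((hR τ hτ.1).const_mul M).hasDerivWithinAt) ?_ ⟨ht, le_rfl⟩
  · exact (div_le_iff₀ (hR0 T le_rfl)).1 (le_max_right _ _)
  · intro τ hτ hEq
    have h1 := hE' τ hτ.1
    have h2 := mul_le_mul_of_nonneg_left (hR' τ hτ.1) (by linarith : 0 ≤ M)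
    have h3 := mul_pos (hδ τ hτ.1) (hR0 τ hτ.1)
    have h4 : (2 * C + 1) * (δ τ * R τ) ≤ M * (δ τ * R τ) := by gcongr
    rw [hEq] at h1
    linarith

/-- A saddle point of the Lagrangian is feasible and minimizes the Lagrangian. -/
theorem saddle_feasible_and_minimal {X Y : Type*} [NormedAddCommGroup X] [InnerProductSpace ℝ X]
    [NormedAddCommGroup Y] [InnerProductSpace ℝ Y] {f : X → ℝ} {A : X →L[ℝ] Y}
    {b : Y} {us : X} {μs : Y}
    (h : ∀ u μ, f us + ⟪μ, A us - b⟫ ≤ f us + ⟪μs, A us - b⟫ ∧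
      f us + ⟪μs, A us - b⟫ ≤ f u + ⟪μs, A u - b⟫) :
    A us = b ∧ ∀ u, f us ≤ f u + ⟪μs, A u - b⟫ := by
  have hfeas : A us = b := by
    have h1 := (h us (μs + (A us - b))).1
    rw [inner_add_left, real_inner_self_eq_norm_sq] at h1
    have h2 : ‖A us - b‖ = 0 := by nlinarith [norm_nonneg (A us - b)]
    exact sub_eq_zero.1 (norm_eq_zero.1 h2)
  refine ⟨hfeas, fun u => ?_⟩
  simpa [hfeas] using (h u μs).2

theorem norm_feasibility_le {X Y : Type*} [NormedAddCommGroup X] [InnerProductSpace ℝ X]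
    [NormedAddCommGroup Y] [InnerProductSpace ℝ Y] {A : X →L[ℝ] Y} {b : Y} {ε : ℝ}
    (hε : 0 ≤ ε) {u₀ u : X} {μ₀ : Y} {N : ℝ}
    (h0' : A u₀ - b - ε • μ₀ = 0) (hμ₀ : ‖μ₀‖ ≤ N) :
    ‖A u - b‖ ≤ ‖A‖ * ‖u - u₀‖ + ε * N := by
  have e : A u - b = A (u - u₀) + ε • μ₀ := by
    rw [map_sub, ← sub_eq_zero.1 h0']; abel
  calc ‖A u - b‖ ≤ ‖A (u - u₀)‖ + ‖ε • μ₀‖ := e ▸ norm_add_le _ _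
    _ ≤ ‖A‖ * ‖u - u₀‖ + ε * N := by
        rw [norm_smul, Real.norm_of_nonneg hε]
        gcongr
        exact A.le_opNorm _

section Rates

variable {X Y : Type*} [NormedAddCommGroup X] [InnerProductSpace ℝ X] [CompleteSpace X]
  [NormedAddCommGroup Y] [InnerProductSpace ℝ Y] [CompleteSpace Y]
  {f : X → ℝ} {f' : X → X} {A : X →L[ℝ] Y} {b : Y}

theorem abs_objective_gap_le (hf : ∀ u, HasGradientAt f (f' u) u)
    (hconv : ConvexOn ℝ Set.univ f) {ε N : ℝ} (hε : 0 < ε) {u₀ us u : X} {μ₀ μs : Y}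
    (h0 : f' u₀ + ContinuousLinearMap.adjoint A μ₀ + ε • u₀ = 0)
    (h0' : A u₀ - b - ε • μ₀ = 0) (hfeas : A us = b)
    (hopt : ∀ u, f us ≤ f u + ⟪μs, A u - b⟫)
    (hN : ‖us‖ ^ 2 + ‖μs‖ ^ 2 ≤ N ^ 2) (hN0 : 0 ≤ N) :
    |f u - f us| ≤ f u - f u₀ + ⟪μ₀, A (u - u₀)⟫ + ε / 2 * (‖u‖ ^ 2 - ‖u₀‖ ^ 2)
      + ε * N ^ 2 + N * (‖A‖ * ‖u - u₀‖) + N * ‖A u - b‖ := by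
  have hz := norm_sq_regularized_saddle_le hf hconv hε h0 h0' hfeas hopt
  have hu₀ : ‖u₀‖ ^ 2 ≤ N ^ 2 := by nlinarith [sq_nonneg ‖μ₀‖]
  have hμ₀ : ‖μ₀‖ ≤ N := abs_le_of_sq_le_sq' (by nlinarith [sq_nonneg ‖u₀‖]) hN0 |>.2
  have hμs : ‖μs‖ ≤ N := abs_le_of_sq_le_sq' (by nlinarith [sq_nonneg ‖us‖]) hN0 |>.2
  have hus : ‖us‖ ^ 2 ≤ N ^ 2 := by nlinarith [sq_nonneg ‖μs‖]
  have hgap := regularized_gap_ge hf hconv h0 u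
  have hgaps := regularized_gap_ge hf hconv h0 us
  have e : A (us - u₀) = -(ε • μ₀) := by
    rw [map_sub, hfeas, ← sub_eq_zero, ← neg_eq_zero, ← h0']; abel
  rw [e, inner_neg_right, inner_smul_right, real_inner_self_eq_norm_sq] at hgaps
  have h1 : -⟪μ₀, A (u - u₀)⟫ ≤ N * (‖A‖ * ‖u - u₀‖) := by
    rw [← inner_neg_left]
    calc ⟪-μ₀, A (u - u₀)⟫ ≤ ‖-μ₀‖ * ‖A (u - u₀)‖ := real_inner_le_norm _ _
      _ ≤ N * (‖A‖ * ‖u - u₀‖) := by rw [norm_neg]; gcongr; exact A.le_opNorm _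
  have h2 : ⟪μs, A u - b⟫ ≤ N * ‖A u - b‖ :=
    (real_inner_le_norm _ _).trans (by gcongr)
  have h3 : ε / 2 * ‖us‖ ^ 2 ≤ ε / 2 * N ^ 2 := by gcongr
  have h4 : ε / 2 * ‖u₀‖ ^ 2 ≤ ε / 2 * N ^ 2 := by gcongr
  have p1 : 0 ≤ ε / 2 * ‖u - u₀‖ ^ 2 := by positivity
  have p2 : 0 ≤ ε / 2 * ‖us - u₀‖ ^ 2 := by positivity
  have p3 : 0 ≤ ε * ‖μ₀‖ ^ 2 := by positivity
  have p4 : 0 ≤ ε * N ^ 2 := by positivity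
  have p5 : 0 ≤ ε / 2 * ‖u‖ ^ 2 := by positivity
  have p6 : 0 ≤ N * (‖A‖ * ‖u - u₀‖) := by positivity
  have p7 : 0 ≤ N * ‖A u - b‖ := by positivity
  rw [abs_le]
  constructor
  · linarith [hopt u]
  · linarith

end Rates

set_option maxHeartbeats 2000000 in
theorem rates_small_p_subcase_one
    {X Y : Type*} [NormedAddCommGroup X] [InnerProductSpace ℝ X] [CompleteSpace X]
    [NormedAddCommGroup Y] [InnerProductSpace ℝ Y] [CompleteSpace Y]
    (f : X → ℝ) (f' : X → X) (hf : ∀ u, HasGradientAt f (f' u) u)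
    (hconv : ConvexOn ℝ Set.univ f)
    (A : X →L[ℝ] Y) (b : Y)
    (L : X → Y → ℝ) (hL : ∀ u lam, L u lam = f u + ⟪lam, A u - b⟫)
    (c p t₀ : ℝ) (hc : 0 < c) (hp0 : 0 < p) (hp1 : p < 1) (ht₀ : 0 < t₀)
    (Lt : ℝ → X → Y → ℝ)
    (hLt : ∀ t u lam, Lt t u lam = L u lam + (c / (2 * t ^ p)) * (‖u‖ ^ 2 - ‖lam‖ ^ 2))
    (gx : ℝ → X → Y → X)
    (hgx : ∀ t u lam, gx t u lam = f' u + ContinuousLinearMap.adjoint A lam + (c / t ^ p) • u)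
    (gl : ℝ → X → Y → Y)
    (hgl : ∀ t u lam, gl t u lam = A u - b - (c / t ^ p) • lam)
    (Om : Set (X × Y))
    (hOm : Om = {z : X × Y | ∀ u μ, L z.1 μ ≤ L z.1 z.2 ∧ L z.1 z.2 ≤ L u z.2})
    (hOmne : Om.Nonempty)
    (xs : X) (ls : Y)
    (hmem : (xs, ls) ∈ Om)
    (hmin : ∀ w ∈ Om, Real.sqrt (‖xs‖ ^ 2 + ‖ls‖ ^ 2) ≤ Real.sqrt (‖w.1‖ ^ 2 + ‖w.2‖ ^ 2))
    (α q γ s : ℝ) (hα : 1 < α) (hq0 : 0 < q) (hq1 : q < 1) (hγ : 0 < γ) (hs : 0 < s)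
    (m m' m'' : ℝ → ℝ)
    (hmpos : ∀ t ≥ t₀, 0 < m t)
    (hmmono : AntitoneOn m (Set.Ici t₀))
    (hmd : ∀ t ≥ t₀, HasDerivAt m (m' t) t)
    (hmd2 : ∀ t ≥ t₀, HasDerivAt m' (m'' t) t)
    (θ : ℝ → ℝ)
    (hθ : ∀ t, θ t = (m t * t ^ (2*q+s) + γ * t ^ q - 2 * m t * γ * q * t ^ (2*q-1)
      - γ * m' t * t ^ (2*q)) / ((α - 1) * (t ^ (q+s) - γ * q * t ^ (q-1))))
    (k₁ k₂ T₁ T₂ : ℝ) (hk₁ : 0 < k₁) (hk₂ : 0 < k₂) (hT₁ : t₀ ≤ T₁) (hT₂ : t₀ ≤ T₂)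
    (hA1 : ∀ t ≥ T₁, γ / t ^ (q+s) ≤ m t ∧ m t ≤ k₁ / t ^ q)
    (hA2 : ∀ t ≥ T₂, t * |m' t| ≤ k₂ * m t ∧ t ^ 2 * |m'' t| ≤ k₂ * m t)
    (x : ℝ → X) (lam : ℝ → Y) (x' x'' : ℝ → X) (lam' : ℝ → Y) (gder : ℝ → X)
    (hx : ∀ t ≥ t₀, HasDerivAt x (x' t) t)
    (hx' : ∀ t ≥ t₀, HasDerivAt x' (x'' t) t)
    (hx''c : ContinuousOn x'' (Set.Ici t₀))
    (hlam : ∀ t ≥ t₀, HasDerivAt lam (lam' t) t)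
    (hlamc : ContinuousOn lam' (Set.Ici t₀))
    (hgder : ∀ t ≥ t₀, HasDerivAt (fun τ => gx τ (x τ) (lam τ)) (gder t) t)
    (hode1 : ∀ t ≥ t₀, m t • x'' t + (α / t ^ q) • x' t + γ • gder t
      + t ^ s • gx t (x t) (lam t) = 0)
    (hode2 : ∀ t ≥ t₀, lam' t = ((α - 1) * (t ^ (q+s) - γ * q * t ^ (q-1)))
      • gl t (x t + θ t • x' t) (lam t))
    (xt : ℝ → X) (lt : ℝ → Y)
    (hsaddle : ∀ t ≥ t₀, gx t (xt t) (lt t) = 0 ∧ gl t (xt t) (lt t) = 0)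
    (xt' : ℝ → X) (lt' : ℝ → Y)
    (hxt : ∀ t ≥ t₀, HasDerivAt xt (xt' t) t)
    (hlt : ∀ t ≥ t₀, HasDerivAt lt (lt' t) t)
    (hxtc : ContinuousOn xt' (Set.Ici t₀))
    (hltc : ContinuousOn lt' (Set.Ici t₀))
    (hp2 : p < (1 - q)/2) (hcond1 : 5*q + 2*s - 1 < 0)
    (hcond2 : 4*q + s + p - 2 < 0) (hp3 : p < 2*q + s)
    :
    ((fun t => L (x t) ls - L xs ls) =O[atTop]
        (fun t => Real.sqrt (m t) * t ^ ((3*q+s-p-1)/2) + t ^ (-p)))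
    ∧ ((fun t => |f (x t) - f xs|) =O[atTop]
        (fun t => Real.sqrt (m t) * t ^ ((3*q+s-p-1)/2) + t ^ (-p)))
    ∧ ((fun t => ‖A (x t) - b‖) =O[atTop]
        (fun t => Real.sqrt (m t) * t ^ ((3*q+s-p-1)/2) + t ^ (-p)))
    ∧ ((fun t => ‖x t - xt t‖ ^ 2 + ‖lam t - lt t‖ ^ 2) =O[atTop]
        (fun t => m t * t ^ (3*q+s-p-1))) := by
  obtain ⟨r, rfl⟩ : ∃ r, α = r + 1 := ⟨α - 1, by ring⟩
  have hr : 0 < r := by linarith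
  rw [add_sub_cancel_right] at *
  simp only [hgx, hgl] at hode1 hode2 hsaddle hgder
  set N : ℝ := √(‖xs‖ ^ 2 + ‖ls‖ ^ 2) with hNdef
  have hN0 : 0 ≤ N := Real.sqrt_nonneg _
  have hN : ‖xs‖ ^ 2 + ‖ls‖ ^ 2 = N ^ 2 := (Real.sq_sqrt (by positivity)).symm
  obtain ⟨hfeas, hopt⟩ : A xs = b ∧ ∀ u, f xs ≤ f u + ⟪ls, A u - b⟫ := by
    rw [hOm] at hmem
    exact saddle_feasible_and_minimal fun u μ => by simpa only [hL] using hmem u μ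
  set ρ : ℝ := 3 * q + s - p - 1 with hρ
  -- coefficient functions
  obtain ⟨P, hP⟩ : ∃ P : ℝ → ℝ, ∀ t, P t = m t * t ^ q := ⟨_, fun _ => rfl⟩
  obtain ⟨P', hP'⟩ : ∃ P' : ℝ → ℝ, ∀ t, P' t = m' t * t ^ q + m t * (q * t ^ (q - 1)) :=
    ⟨_, fun _ => rfl⟩
  obtain ⟨P'', hP''⟩ : ∃ P'' : ℝ → ℝ, ∀ t, P'' t = m'' t * t ^ q + m' t * (q * t ^ (q - 1))
      + (m' t * (q * t ^ (q - 1)) + m t * (q * ((q - 1) * t ^ (q - 1 - 1)))) := ⟨_, fun _ => rfl⟩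
  obtain ⟨B, hB⟩ : ∃ B : ℝ → ℝ, ∀ t, B t = t ^ (q + s) - γ * q * t ^ (q - 1) := ⟨_, fun _ => rfl⟩
  obtain ⟨B', hB'⟩ : ∃ B' : ℝ → ℝ, ∀ t, B' t = (q + s) * t ^ (q + s - 1)
      - γ * q * ((q - 1) * t ^ (q - 1 - 1)) := ⟨_, fun _ => rfl⟩
  have hpow (a : ℝ) (t : ℝ) (ht : t₀ ≤ t) : HasDerivAt (fun τ : ℝ => τ ^ a) (a * t ^ (a - 1)) t :=
    Real.hasDerivAt_rpow_const (Or.inl (ht₀.trans_le ht).ne')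
  have hPd : ∀ t ≥ t₀, HasDerivAt P (P' t) t := fun t ht => by
    rw [funext hP, hP']; exact (hmd t ht).mul (hpow q t ht)
  have hP'd : ∀ t ≥ t₀, HasDerivAt P' (P'' t) t := fun t ht => by
    rw [funext hP', hP'']
    exact ((hmd2 t ht).mul (hpow q t ht)).add ((hmd t ht).mul ((hpow (q - 1) t ht).const_mul q))
  have hBd : ∀ t ≥ t₀, HasDerivAt B (B' t) t := fun t ht => by
    rw [funext hB, hB']
    exact (hpow (q + s) t ht).sub ((hpow (q - 1) t ht).const_mul (γ * q))
  have hεd : ∀ t ≥ t₀, HasDerivAt (fun τ => c / τ ^ p) (-(p * t⁻¹ * (c / t ^ p))) t :=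
    fun t ht => by
      have ht' := ht₀.trans_le ht
      have h1 : t ^ p ≠ 0 := (rpow_pos_of_pos ht' p).ne'
      refine ((hasDerivAt_const t c).div (hpow p t ht) h1).congr_deriv ?_
      rw [rpow_sub_one ht'.ne']
      field_simp
      ring
  obtain ⟨T, hT⟩ := eventually_atTop.1 (eventually_coeff_bounds (ρ := ρ) hq0 hq1 hγ hs hc hr
    hmpos hk₁ hk₂ hA1 hA2 (by linarith) hp3 hP hP' hP'' hB hB')
  have hTt₀ (t : ℝ) (ht : T ≤ t) : t₀ ≤ t := (hT t ht).1
  have hε0 (t : ℝ) (ht : T ≤ t) : 0 < c / t ^ p :=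
    div_pos hc (rpow_pos_of_pos (ht₀.trans_le (hTt₀ t ht)) p)
  -- the regularized saddle path
  have hz (t : ℝ) (ht : T ≤ t) : ‖xt t‖ ^ 2 + ‖lt t‖ ^ 2 ≤ N ^ 2 :=
    (norm_sq_regularized_saddle_le hf hconv (hε0 t ht) (hsaddle t (hTt₀ t ht)).1
      (hsaddle t (hTt₀ t ht)).2 hfeas hopt).trans_eq hN
  have hz' (t : ℝ) (ht : T ≤ t) : ‖xt' t‖ ^ 2 + ‖lt' t‖ ^ 2 ≤ (N * t⁻¹) ^ 2 := by
    have ht0 := hTt₀ t ht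
    have hτ : 0 < t⁻¹ := inv_pos.2 (ht₀.trans_le ht0)
    have h1 := norm_sq_deriv_regularized_saddle_le (ε := fun τ => c / τ ^ p) (r := p * t⁻¹)
      hf hconv (hε0 t ht) (hεd t ht0) (fun τ hτ => (hsaddle τ (ht0.trans hτ)).1)
      (fun τ hτ => (hsaddle τ (ht0.trans hτ)).2) (hxt t ht0) (hlt t ht0)
    calc _ ≤ (p * t⁻¹) ^ 2 * (‖xt t‖ ^ 2 + ‖lt t‖ ^ 2) := h1
      _ ≤ (1 * t⁻¹) ^ 2 * N ^ 2 := by gcongr; exact hz t ht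
      _ = _ := by ring
  -- the energy and its derivative
  have hEd (t : ℝ) (ht : T ≤ t) := by
    have ht0 := hTt₀ t ht
    have ht' := ht₀.trans_le ht0
    exact hasDerivAt_energy (A := A) (b := b) (ε := fun τ => c / τ ^ p) (Γ := fun τ => γ * τ ^ q)
      (Θ := fun τ => P τ * B τ + γ * τ ^ q * (1 - P' τ)) (σ := fun τ => 1 - P' τ)
      (r := r) (κ := t ^ (q + s)) (B := B t)
      hf (hx t ht0) (hx' t ht0) (hgder t ht0) (hlam t ht0) (hxt t ht0) (hlt t ht0) (hεd t ht0)
      (hPd t ht0) ((hpow q t ht0).const_mul γ)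
      (((hPd t ht0).mul (hBd t ht0)).add (((hpow q t ht0).const_mul γ).mul
        ((hP'd t ht0).const_sub 1)))
      ((hP'd t ht0).const_sub 1) rfl (by rw [hB]; ring) rfl rfl (hsaddle t ht0).1
      (hsaddle t ht0).2 rfl
      (by
        have h1 : t ^ q • (m t • x'' t + ((r + 1) / t ^ q) • x' t + γ • gder t
          + t ^ s • (f' (x t) + ContinuousLinearMap.adjoint A (lam t) + (c / t ^ p) • x t)) = 0 := by
          rw [hode1 t ht0, smul_zero]
        rw [← h1, hP, rpow_add ht']
        have h2 : t ^ q ≠ 0 := (rpow_pos_of_pos ht' q).ne'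
        match_scalars <;> field_simp)
      (by
        have hBt : B t ≠ 0 := by
          have h1 := (hT t ht).2.2.2.1.2.2.1
          have h2 : 0 < t ^ (q + s) := rpow_pos_of_pos ht' _
          linarith
        have hΘ : r * B t * θ t = P t * B t + γ * t ^ q * (1 - P' t) := by
          rw [hθ, ← hB, mul_div_cancel₀ _ (mul_ne_zero hr.ne' hBt), hP, hB, hP',
            rpow_sub_one ht'.ne' q, rpow_sub_one ht'.ne' (2 * q),
            show 2 * q + s = q + (q + s) by ring, two_mul q, rpow_add ht' q (q + s),
            rpow_add ht' q q]
          ring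
        rw [hode2 t ht0, ← hB, ← hΘ, map_add, map_smul]
        module)
  obtain ⟨D, hD⟩ : ∃ D : ℝ → ℝ, ∀ t, D t = f (x t) - f (xt t) + ⟪lt t, A (x t - xt t)⟫
    + c / t ^ p / 2 * (‖x t‖ ^ 2 - ‖xt t‖ ^ 2) := ⟨_, fun _ => rfl⟩
  have hDge (t : ℝ) (ht : T ≤ t) : 0 ≤ D t := by
    rw [hD]
    have h1 := hε0 t ht
    exact le_trans (by positivity) (regularized_gap_ge hf hconv (hsaddle t (hTt₀ t ht)).1 (x t))
  have hRd (t : ℝ) (ht : T ≤ t) : HasDerivAt (fun τ => m τ * τ ^ ρ)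
      (m' t * t ^ ρ + m t * (ρ * t ^ (ρ - 1))) t :=
    (hmd t (hTt₀ t ht)).mul (hpow ρ t (hTt₀ t ht))
  have hR0 (t : ℝ) (ht : T ≤ t) : 0 < m t * t ^ ρ :=
    mul_pos (hmpos t (hTt₀ t ht)) (rpow_pos_of_pos (ht₀.trans_le (hTt₀ t ht)) ρ)
  have hRel (t : ℝ) (ht : T ≤ t) :
      P t * t ^ (q + s) * (c / t ^ p) * t⁻¹ = c * (t ^ (-q) * (m t * t ^ ρ)) := by
    have ht' := ht₀.trans_le (hTt₀ t ht)
    have h1 : t ^ ρ = t ^ q * t ^ q * t ^ (q + s) * (t ^ p)⁻¹ * t⁻¹ := by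
      rw [← rpow_neg ht'.le, ← rpow_neg_one, ← rpow_add ht', ← rpow_add ht', ← rpow_add ht',
        ← rpow_add ht', hρ]
      ring_nf
    rw [h1, hP, rpow_neg ht'.le]
    have h2 : t ^ q ≠ 0 := (rpow_pos_of_pos ht' q).ne'
    field_simp
  set C₀ : ℝ := 2 * r ^ 2 * N ^ 2 + 25 * ‖A‖ ^ 2 * N ^ 2 * k₁ * (1 / c ^ 2) / r
    + 4 * (3 / 2 * r + r ^ 2) ^ 2 * N ^ 2 * (1 / c ^ 2) / (r * γ)
    + N ^ 2 * (1 / c ^ 2) / (r * γ) + 5 / 4 * N ^ 2 with hC₀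
  obtain ⟨M, hM0, hM⟩ := exists_le_mul_of_deriv_le (C := C₀ * c) (δ := fun t => t ^ (-q))
    (by positivity) hEd hRd (fun t ht => rpow_pos_of_pos (ht₀.trans_le (hTt₀ t ht)) _) hR0
    (fun t ht => (hT t ht).2.2.2.2.2.2.2.2.2.2.2.2) (fun t ht => by
      obtain ⟨ht0, ht1, ⟨a1, a2, a3, a4, a5⟩, ⟨b1, b2, b3, b4, b5⟩, c1, c2, c3, c4, c5, c6, c7,
        c8, -⟩ := hT t ht
      have ht' := ht₀.trans_le ht0
      have hz1 := hz t ht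
      have hz2 := hz' t ht
      have hτ0 : 0 < t⁻¹ := inv_pos.2 ht'
      have hΘ' : P' t * B t + P t * B' t
          + (γ * (q * t ^ (q - 1)) * (1 - P' t) + γ * t ^ q * -P'' t)
          + t ^ (-q) * (P t * B t + γ * t ^ q * (1 - P' t)) ≤ r * B t := by
        rw [rpow_sub_one ht'.ne']
        refine le_of_eq_of_le ?_ c1
        ring
      have := energy_deriv_le A (e := x t - xt t) (w := x' t) (a := xt' t) (η := lam t - lt t)
        (d := lt' t)
        (G := f' (x t) + ContinuousLinearMap.adjoint A (lam t) + (c / t ^ p) • x t)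
        (n := ‖x t‖ ^ 2 - ‖xt t‖ ^ 2) (p := p)
        hr (rpow_pos_of_pos ht' (-q)) hτ0 (hε0 t ht) a1 a2 hγ a4 a5 a3 b1 b2 b3
        (by have : 0 < P t * t ^ (q + s) := by positivity
            linarith)
        b5 hΘ' c2 c3 c4 c5 c6 c7 hp0.le hp1.le hN0
        (abs_le_of_sq_le_sq' (by linarith [sq_nonneg ‖lt' t‖]) (by positivity)).2
        (abs_le_of_sq_le_sq' (by linarith [sq_nonneg ‖xt' t‖]) (by positivity)).2
        (hDge t ht) ((hD t).symm ▸ regularized_gap_add_le hf hconv (x t) (xt t) (lt t))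
        (by linarith [sq_nonneg ‖x t‖, sq_nonneg ‖lt t‖])
      rw [hRel t ht, ← hC₀, hD] at this
      refine this.trans_eq ?_
      ring)
  -- consequences of the energy bound
  have hdist (t : ℝ) (ht : T ≤ t) :
      ‖x t - xt t‖ ^ 2 + ‖lam t - lt t‖ ^ 2 ≤ (4 * M / r + 2 * M) * (m t * t ^ ρ) ∧
        D t ≤ 2 * M * t ^ (-p) := by
    obtain ⟨ht0, ht1, ⟨a1, a2, a3, a4, a5⟩, ⟨b1, b2, b3, b4, b5⟩, c1, c2, c3, c4, c5, c6, c7,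
      c8, -⟩ := hT t ht
    have ht' := ht₀.trans_le ht0
    have h1 := hM t ht
    rw [← hD] at h1
    have hU : 0 < P t * t ^ (q + s) := by positivity
    have h2 : P t * t ^ (q + s) / 2 * D t ≤ (P t * B t + γ * t ^ q * (1 - P' t)) * D t :=
      mul_le_mul_of_nonneg_right b4 (hDge t ht)
    have h3 : r / 2 * (1 / 2 * ‖x t - xt t‖ ^ 2) ≤ r / 2 * ((1 - P' t) * ‖x t - xt t‖ ^ 2) := by
      gcongr
    have h4 : 0 ≤ P t * t ^ (q + s) / 2 * D t := mul_nonneg (by positivity) (hDge t ht)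
    have h5 : 0 ≤ 1 / 2 * ‖r • (x t - xt t) + P t • x' t + (γ * t ^ q) •
      (f' (x t) + ContinuousLinearMap.adjoint A (lam t) + (c / t ^ p) • x t)‖ ^ 2 := by positivity
    have h6 : 0 ≤ r / 2 * (1 / 2 * ‖x t - xt t‖ ^ 2) := by positivity
    have h7 : 0 ≤ 1 / 2 * ‖lam t - lt t‖ ^ 2 := by positivity
    constructor
    · have h8 : ‖x t - xt t‖ ^ 2 ≤ 4 / r * (M * (m t * t ^ ρ)) := by
        calc ‖x t - xt t‖ ^ 2 = 4 / r * (r / 2 * (1 / 2 * ‖x t - xt t‖ ^ 2)) := by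
              field_simp; norm_num
          _ ≤ _ := mul_le_mul_of_nonneg_left (by linarith) (by positivity)
      have h9 : ‖lam t - lt t‖ ^ 2 ≤ 2 * (M * (m t * t ^ ρ)) := by linarith
      calc _ ≤ 4 / r * (M * (m t * t ^ ρ)) + 2 * (M * (m t * t ^ ρ)) := add_le_add h8 h9
        _ = _ := by ring
    · have h8 : P t * t ^ (q + s) / 2 * D t ≤ M * (m t * t ^ ρ) := by linarith
      have hδ : 0 < t ^ (-q) := by positivity
      have hω : c / t ^ p = c * t ^ (-p) := by rw [rpow_neg ht'.le, div_eq_mul_inv]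
      have h9 : m t * t ^ ρ ≤ P t * t ^ (q + s) * t ^ (-p) := by
        have h10 := hRel t ht
        rw [hω] at h10
        have h11 : P t * t ^ (q + s) * t ^ (-p) * t⁻¹ = t ^ (-q) * (m t * t ^ ρ) := by
          apply mul_left_cancel₀ hc.ne'
          linarith
        have h12 : P t * t ^ (q + s) * t ^ (-p) * t⁻¹ ≤ P t * t ^ (q + s) * t ^ (-p) * t ^ (-q) := by
          gcongr
        refine le_of_mul_le_mul_left ?_ hδ
        linarith
      have h10 : M * (m t * t ^ ρ) ≤ M * (P t * t ^ (q + s) * t ^ (-p)) := by gcongr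
      refine le_of_mul_le_mul_left ?_ (half_pos hU)
      linarith
  set M₁ : ℝ := 4 * M / r + 2 * M with hM₁
  have hM₁0 : 0 < M₁ := by positivity
  have hroot (t : ℝ) (ht : T ≤ t) : ‖x t - xt t‖ ≤ √M₁ * (√(m t) * t ^ (ρ / 2)) := by
    have ht' := ht₀.trans_le (hTt₀ t ht)
    refine abs_le_of_sq_le_sq' ?_ (by positivity) |>.2
    rw [mul_pow, mul_pow, Real.sq_sqrt hM₁0.le, Real.sq_sqrt (hmpos t (hTt₀ t ht)).le,
      ← rpow_natCast (t ^ (ρ / 2)), ← rpow_mul ht'.le]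
    norm_num
    linarith [(hdist t ht).1, sq_nonneg ‖lam t - lt t‖]
  have hfe (t : ℝ) (ht : T ≤ t) : ‖A (x t) - b‖
      ≤ (‖A‖ * √M₁ + c * N) * (√(m t) * t ^ (ρ / 2) + t ^ (-p)) := by
    have ht' := ht₀.trans_le (hTt₀ t ht)
    have h1 := norm_feasibility_le (u := x t) (hε0 t ht).le (hsaddle t (hTt₀ t ht)).2
      (abs_le_of_sq_le_sq' (by linarith [hz t ht, sq_nonneg ‖xt t‖]) hN0).2
    have hω : c / t ^ p = c * t ^ (-p) := by rw [rpow_neg ht'.le, div_eq_mul_inv]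
    rw [hω] at h1
    have h2 : ‖A‖ * ‖x t - xt t‖ ≤ ‖A‖ * (√M₁ * (√(m t) * t ^ (ρ / 2))) := by
      gcongr; exact hroot t ht
    have h3 : 0 ≤ ‖A‖ * √M₁ * t ^ (-p) := by positivity
    have h4 : 0 ≤ c * N * (√(m t) * t ^ (ρ / 2)) := by positivity
    linarith
  set K₁ : ℝ := ‖A‖ * √M₁ + c * N with hK₁
  set K₂ : ℝ := 2 * M + c * N ^ 2 + N * (‖A‖ * √M₁) + N * K₁ with hK₂
  have hobj (t : ℝ) (ht : T ≤ t) : |f (x t) - f xs|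
      ≤ K₂ * (√(m t) * t ^ (ρ / 2) + t ^ (-p)) := by
    have ht' := ht₀.trans_le (hTt₀ t ht)
    have h1 := abs_objective_gap_le (u := x t) hf hconv (hε0 t ht) (hsaddle t (hTt₀ t ht)).1
      (hsaddle t (hTt₀ t ht)).2 hfeas hopt hN.le hN0
    rw [← hD] at h1
    have hω : c / t ^ p = c * t ^ (-p) := by rw [rpow_neg ht'.le, div_eq_mul_inv]
    rw [hω] at h1
    have h2 : N * (‖A‖ * ‖x t - xt t‖) ≤ N * (‖A‖ * (√M₁ * (√(m t) * t ^ (ρ / 2)))) := by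
      gcongr; exact hroot t ht
    have h3 : N * ‖A (x t) - b‖ ≤ N * (K₁ * (√(m t) * t ^ (ρ / 2) + t ^ (-p))) := by
      gcongr; exact hfe t ht
    have h4 : 0 ≤ N * (‖A‖ * √M₁) * t ^ (-p) := by positivity
    have h5 : 0 ≤ (2 * M + c * N ^ 2) * (√(m t) * t ^ (ρ / 2)) := by positivity
    have h6 := (hdist t ht).2
    rw [hK₂]
    linarith
  have hnn (t : ℝ) (ht : T ≤ t) : 0 ≤ √(m t) * t ^ (ρ / 2) + t ^ (-p) := by
    have ht' := ht₀.trans_le (hTt₀ t ht)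
    positivity
  refine ⟨IsBigO.of_bound (K₂ + N * K₁) ?_, IsBigO.of_bound K₂ ?_, IsBigO.of_bound K₁ ?_,
    IsBigO.of_bound M₁ ?_⟩ <;> filter_upwards [eventually_ge_atTop T] with t ht
  · rw [Real.norm_of_nonneg (hnn t ht), Real.norm_eq_abs, hL, hL, hfeas, sub_self, inner_zero_right,
      add_zero, add_sub_right_comm]
    have h1 : |⟪ls, A (x t) - b⟫| ≤ N * (K₁ * (√(m t) * t ^ (ρ / 2) + t ^ (-p))) :=
      (abs_real_inner_le_norm _ _).trans (mul_le_mul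
        (abs_le_of_sq_le_sq' (by linarith [sq_nonneg ‖xs‖]) hN0).2 (hfe t ht)
        (norm_nonneg _) hN0)
    calc _ ≤ |f (x t) - f xs| + |⟪ls, A (x t) - b⟫| := abs_add_le _ _
      _ ≤ _ := add_le_add (hobj t ht) h1
      _ = _ := by ring
  · rw [Real.norm_of_nonneg (hnn t ht), Real.norm_eq_abs, abs_abs]
    exact hobj t ht
  · rw [Real.norm_of_nonneg (hnn t ht), Real.norm_eq_abs, abs_norm]
    exact hfe t ht
  · rw [Real.norm_of_nonneg (by positivity), Real.norm_of_nonneg (hR0 t ht).le]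
    exact (hdist t ht).1
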